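/- Suppose V : E → ℝ is differentiable at x_f, V(x_f) = 0, V(x) ≥ 0 for all x in some neighborhood of x_f, and V satisfies the stationary HJB equation at x_f. If moreover there exists a constant c > 0 such that L x_f u ≥ c for every u ∈ 𝒰, then a contradiction follows (i.e., no function V can simultaneously be differentiable at x_f, vanish at x_f, be nonnegative on a neighborhood of x_f, and satisfy the stationary HJB equation at x_f). In particular, any nonnegative value function vanishing at x_f that satisfies the HJB equation with uniformly positive running cost at x_f fails to be differentiable at x_f. -/

import Mathlib

open RealInnerProductSpace

/-- A function `V` satisfies the stationary HJB equation at `x`: `V` is differentiable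
at `x` and `0` is the greatest lower bound of `{L x u + ⟪∇V(x), f x u⟫ : u ∈ 𝒰}`. -/
def SatisfiesHJBAt {E : Type*} [NormedAddCommGroup E] [InnerProductSpace ℝ E]
    [CompleteSpace E] {m : ℕ} (𝒰 : Set (Fin m → ℝ))
    (f : E → (Fin m → ℝ) → E) (L : E → (Fin m → ℝ) → ℝ)
    (V : E → ℝ) (x : E) : Prop :=
  DifferentiableAt ℝ V x ∧
    IsGLB ((fun u => L x u + ⟪gradient V x, f x u⟫) '' 𝒰) 0

theorem stmt0 {E : Type*} [NormedAddCommGroup E] [InnerProductSpace ℝ E] [CompleteSpace E]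
    {m : ℕ} (𝒰 : Set (Fin m → ℝ)) (h𝒰 : 𝒰.Nonempty)
    (f : E → (Fin m → ℝ) → E) (L : E → (Fin m → ℝ) → ℝ)
    (x_f : E) (V : E → ℝ)
    (hdiff : DifferentiableAt ℝ V x_f)
    (hV0 : V x_f = 0)
    (hVnonneg : ∀ᶠ x in nhds x_f, 0 ≤ V x)
    (hHJB : SatisfiesHJBAt 𝒰 f L V x_f)
    (hL : ∃ c > (0 : ℝ), ∀ u ∈ 𝒰, c ≤ L x_f u) :
    False := by
  obtain ⟨c, hc, hcL⟩ := hL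
  have hmin : IsLocalMin V x_f := hVnonneg.mono fun x hx => hV0.trans_le hx
  have hgrad : gradient V x_f = 0 := by simp [gradient, hmin.fderiv_eq_zero]
  refine hc.not_ge (hHJB.2.2 ?_)
  rintro _ ⟨u, hu, rfl⟩
  simpa [hgrad] using hcL u hu
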